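/- arXiv:2401.11658 — 5 statements merged into one kernel-verified Lean document; each statement's English description precedes it below -/
import Mathlib

section
/- Under assumptions (A1)–(A4), there exists a unique absolutely continuous function x : [−τ, (n+1)τ] → ℝ^d solving the delay differential equation, i.e. x(t) = φ(t) for t ∈ [−τ, 0), x(0) = φ(0), and x(t) = φ(0) + ∫₀ᵗ f(s, x(s), x(s−τ)) ds for all t ∈ [0, (n+1)τ]. -/
open Set MeasureTheory intervalIntegral

section helpers
variable {E : Type*} [NormedAddCommGroup E] [NormedSpace ℝ E] [CompleteSpace E]

lemma ode_integrable {T : ℝ} (g : ℝ → E → E)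
    (hm : ∀ u : ℝ → E, Continuous u →
      AEStronglyMeasurable (fun s => g s (u s)) (volume.restrict (Icc 0 T)))
    (C M : ℝ) (hM : 0 ≤ M)
    (hC : ∀ s ∈ Icc 0 T, ‖g s 0‖ ≤ C)
    (hLip : ∀ s ∈ Icc 0 T, ∀ x y, ‖g s x - g s y‖ ≤ M * ‖x - y‖)
    (u : ℝ → E) (hu : Continuous u) :
    IntegrableOn (fun s => g s (u s)) (Icc 0 T) := by
  obtain ⟨B, hB⟩ := (isCompact_Icc (a := (0:ℝ)) (b := T)).exists_bound_of_continuousOn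
    hu.continuousOn
  refine Integrable.of_bound (hm u hu) (C + M * B) ?_
  filter_upwards [ae_restrict_mem measurableSet_Icc] with s hs
  have h1 := hLip s hs (u s) 0
  have h2 := hC s hs
  have h3 := hB s hs
  have h4 : ‖g s (u s)‖ ≤ ‖g s (u s) - g s 0‖ + ‖g s 0‖ := by
    simpa using norm_add_le (g s (u s) - g s 0) (g s 0)
  rw [sub_zero] at h1
  have h5 := mul_le_mul_of_nonneg_left h3 hM
  linarith

lemma ode_exists {T : ℝ} (hT : 0 ≤ T) (g : ℝ → E → E)
    (hm : ∀ u : ℝ → E, Continuous u →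
      AEStronglyMeasurable (fun s => g s (u s)) (volume.restrict (Icc 0 T)))
    (C M : ℝ) (hM : 0 ≤ M)
    (hC : ∀ s ∈ Icc 0 T, ‖g s 0‖ ≤ C)
    (hLip : ∀ s ∈ Icc 0 T, ∀ x y, ‖g s x - g s y‖ ≤ M * ‖x - y‖) (x₀ : E) :
    ∃ u : ℝ → E, Continuous u ∧ IntegrableOn (fun s => g s (u s)) (Icc 0 T) ∧
      (∀ t ∈ Icc 0 T, u t = x₀ + ∫ s in (0:ℝ)..t, g s (u s)) ∧
      ∀ y : ℝ → E, ContinuousOn y (Icc 0 T) →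
        (∀ t ∈ Icc 0 T, y t = x₀ + ∫ s in (0:ℝ)..t, g s (y s)) →
        ∀ t ∈ Icc 0 T, y t = u t := by
  have hint := ode_integrable g hm C M hM hC hLip
  set l : ℝ := 2 * M + 1 with hl
  have hlpos : 0 < l := by positivity
  -- extension
  let ext : C(Icc (0:ℝ) T, E) → ℝ → E := fun v s => Real.exp (l * s) • IccExtend hT v s
  have hext : ∀ v, Continuous (ext v) := fun v =>
    (by fun_prop : Continuous fun s : ℝ => Real.exp (l * s)).smul v.continuous.Icc_extend'
  have hprim : ∀ v, ContinuousOn (fun t => ∫ s in (0:ℝ)..t, g s (ext v s)) (Icc 0 T) := by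
    intro v
    have := continuousOn_primitive_interval (μ := volume) (a := 0) (b := T)
      (f := fun s => g s (ext v s)) (by rw [uIcc_of_le hT]; exact hint _ (hext v))
    rwa [uIcc_of_le hT] at this
  let Φ : C(Icc (0:ℝ) T, E) → C(Icc (0:ℝ) T, E) := fun v =>
    ⟨fun t => Real.exp (-(l * t)) • (x₀ + ∫ s in (0:ℝ)..t, g s (ext v s)), by
      refine Continuous.smul (by fun_prop) (continuous_const.add ?_)
      exact continuousOn_iff_continuous_domRestrict.1 (hprim v)⟩
  have hII : ∀ v, ∀ t ∈ Icc (0:ℝ) T,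
      IntervalIntegrable (fun s => g s (ext v s)) volume 0 t := by
    intro v t ht
    rw [intervalIntegrable_iff_integrableOn_Icc_of_le ht.1]
    exact (hint _ (hext v)).mono_set (Icc_subset_Icc_right ht.2)
  have hcontr : ContractingWith (1/2) Φ := by
    refine ⟨by rw [← NNReal.coe_lt_coe]; norm_num, LipschitzWith.of_dist_le_mul fun v w => ?_⟩
    rw [ContinuousMap.dist_le (by positivity)]
    rintro ⟨t, ht⟩
    have hD := dist_nonneg (x := v) (y := w)
    set D := dist v w with hDdef
    have e1 : dist (Φ v ⟨t, ht⟩) (Φ w ⟨t, ht⟩) =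
        Real.exp (-(l * t)) * ‖∫ s in (0:ℝ)..t, (g s (ext v s) - g s (ext w s))‖ := by
      rw [intervalIntegral.integral_sub (hII v t ht) (hII w t ht), dist_eq_norm]
      simp only [Φ, ContinuousMap.coe_mk]
      rw [← smul_sub, norm_smul, add_sub_add_left_eq_sub, Real.norm_eq_abs, Real.abs_exp]
    have e2 : ‖∫ s in (0:ℝ)..t, (g s (ext v s) - g s (ext w s))‖ ≤
        ∫ s in (0:ℝ)..t, (M * D) * Real.exp (l * s) := by
      refine intervalIntegral.norm_integral_le_of_norm_le ht.1 ?_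
        (Continuous.intervalIntegrable (by fun_prop) _ _)
      refine Filter.Eventually.of_forall fun s hs => ?_
      have hs' : s ∈ Icc 0 T := ⟨hs.1.le, hs.2.trans ht.2⟩
      refine (hLip s hs' _ _).trans ?_
      have : ‖ext v s - ext w s‖ ≤ Real.exp (l * s) * D := by
        simp only [ext]
        rw [← smul_sub, norm_smul, Real.norm_eq_abs, Real.abs_exp]
        refine mul_le_mul_of_nonneg_left ?_ (Real.exp_pos _).le
        rw [← dist_eq_norm]
        exact ContinuousMap.dist_apply_le_dist _
      calc _ ≤ M * (Real.exp (l * s) * D) := mul_le_mul_of_nonneg_left this hM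
        _ = _ := by ring
    have e3 : ∫ s in (0:ℝ)..t, (M * D) * Real.exp (l * s)
        = (M * D) * ((Real.exp (l * t) - 1) / l) := by
      rw [intervalIntegral.integral_const_mul]
      congr 1
      rw [intervalIntegral.integral_comp_mul_left (fun s => Real.exp s) hlpos.ne']
      simp [div_eq_inv_mul]
    rw [e1]
    refine (mul_le_mul_of_nonneg_left (e2.trans_eq e3) (Real.exp_pos _).le).trans ?_
    have e4 : Real.exp (-(l*t)) * ((M * D) * ((Real.exp (l * t) - 1) / l))
        = (M / l) * D * (1 - Real.exp (-(l*t))) := by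
      have : Real.exp (-(l*t)) * Real.exp (l*t) = 1 := by rw [← Real.exp_add]; simp
      calc _ = (M / l) * D * (Real.exp (-(l*t)) * Real.exp (l*t) - Real.exp (-(l*t))) := by ring
        _ = _ := by rw [this]
    rw [e4]
    have e5 : M / l ≤ 1/2 := by rw [div_le_iff₀ hlpos]; linarith
    have e6 : 1 - Real.exp (-(l*t)) ≤ 1 := by linarith [Real.exp_pos (-(l*t))]
    have e7 : M / l * D ≤ 1/2 * D := mul_le_mul_of_nonneg_right e5 hD
    have e8 : 0 ≤ M / l * D := by positivity
    calc _ ≤ M / l * D * 1 := mul_le_mul_of_nonneg_left e6 e8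
      _ ≤ 1/2 * D := by linarith
      _ = _ := by simp
  obtain ⟨v, hv⟩ : ∃ v, Φ v = v := ⟨_, hcontr.fixedPoint_isFixedPt⟩
  have hmul : ∀ (t : ℝ) (a : E), Real.exp (l * t) • Real.exp (-(l * t)) • a = a := by
    intro t a
    rw [smul_smul, ← Real.exp_add]; simp
  have hmul' : ∀ (t : ℝ) (a : E), Real.exp (-(l * t)) • Real.exp (l * t) • a = a := by
    intro t a
    rw [smul_smul, ← Real.exp_add]; simp
  refine ⟨ext v, hext v, hint _ (hext v), ?_, ?_⟩
  · intro t ht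
    have h1 : v ⟨t, ht⟩ = Real.exp (-(l * t)) • (x₀ + ∫ s in (0:ℝ)..t, g s (ext v s)) := by
      conv_lhs => rw [← hv]
      rfl
    have h2 : ext v t = Real.exp (l * t) • v ⟨t, ht⟩ := by
      simp only [ext]; rw [IccExtend_of_mem _ _ ht]
    rw [h2, h1, hmul]
  · intro y hy hyeq
    let w : C(Icc (0:ℝ) T, E) := ⟨fun t => Real.exp (-(l * t)) • y t,
      Continuous.smul (by fun_prop) (continuousOn_iff_continuous_domRestrict.1 hy)⟩
    have hw : ∀ t ∈ Icc 0 T, ext w t = y t := by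
      intro t ht
      simp only [ext]
      rw [IccExtend_of_mem _ _ ht]
      exact hmul t (y t)
    have hfix : Φ w = w := by
      ext1 ⟨t, ht⟩
      change Real.exp (-(l * t)) • (x₀ + ∫ s in (0:ℝ)..t, g s (ext w s))
        = Real.exp (-(l * t)) • y t
      rw [hyeq t ht]
      congr 2
      refine intervalIntegral.integral_congr fun s hs => ?_
      rw [uIcc_of_le ht.1] at hs
      rw [hw s ⟨hs.1, hs.2.trans ht.2⟩]
    have hwv : w = v := hcontr.fixedPoint_unique' hfix hv
    intro t ht
    rw [← hw t ht, hwv]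

lemma cara_meas [MeasurableSpace E] [BorelSpace E] [SecondCountableTopology E] {T : ℝ}
    (f : ℝ → E → E → E)
    (hc : ∀ t ∈ Icc 0 T, Continuous (fun p : E × E => f t p.1 p.2))
    (hm : ∀ x z, Measurable (fun t => f t x z))
    (u z : ℝ → E) (hu : Continuous u) (hz : ContinuousOn z (Icc 0 T)) :
    AEStronglyMeasurable (fun s => f s (u s) (z s)) (volume.restrict (Icc 0 T)) := by
  rcases lt_or_ge T 0 with hT | hT
  · simp [Icc_eq_empty (not_le.2 hT)]
  let F : E × E → ℝ → E := fun p => (Icc 0 T).indicator (fun t => f t p.1 p.2)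
  have hF : StronglyMeasurable (Function.uncurry F) := by
    apply stronglyMeasurable_uncurry_of_continuous_of_stronglyMeasurable
    · intro t
      by_cases ht : t ∈ Icc 0 T
      · simpa [F, indicator_of_mem ht] using hc t ht
      · simp only [F, indicator_of_notMem ht]; exact continuous_const
    · intro p
      exact ((hm p.1 p.2).indicator measurableSet_Icc).stronglyMeasurable
  let z' := IccExtend hT ((Icc 0 T).domRestrict z)
  have hz' : Continuous z' := (continuousOn_iff_continuous_domRestrict.1 hz).Icc_extend'
  have h := hF.comp_measurable
    ((hu.measurable.prodMk hz'.measurable).prodMk measurable_id)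
  refine h.aestronglyMeasurable.congr ?_
  filter_upwards [ae_restrict_mem measurableSet_Icc] with s hs
  simp only [Function.comp, Function.uncurry, F, id, indicator_of_mem hs, z']
  rw [IccExtend_of_mem _ _ hs]; rfl

end helpers

/-- Under assumptions (A1)–(A4) there exists a unique absolutely continuous solution of the
delay differential equation `x'(t) = f(t, x(t), x(t−τ))` on `[0,(n+1)τ]` with
`x(t) = φ(t)` on `[−τ,0)`, expressed through the integral equation
`x(t) = φ(0) + ∫₀ᵗ f(s, x(s), x(s−τ)) ds`. -/
theorem dde_existence_uniqueness
    (d : ℕ) (n : ℕ) (τ : ℝ) (hτ : 0 < τ)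
    (f : ℝ → EuclideanSpace ℝ (Fin d) → EuclideanSpace ℝ (Fin d) → EuclideanSpace ℝ (Fin d))
    (φ : ℝ → EuclideanSpace ℝ (Fin d))
    -- (A1)
    (hA1f : ∀ t ∈ Set.Icc (0:ℝ) (((n:ℝ)+1)*τ),
      Continuous (fun p : EuclideanSpace ℝ (Fin d) × EuclideanSpace ℝ (Fin d) => f t p.1 p.2))
    (hA1φ : ContinuousOn φ (Set.Icc (-τ) 0))
    -- (A2)
    (hA2 : ∀ x z : EuclideanSpace ℝ (Fin d), Measurable (fun t => f t x z))
    -- (A3)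
    (K : ℝ) (hK : 0 < K)
    (hA3 : ∀ t ∈ Set.Icc (0:ℝ) (((n:ℝ)+1)*τ), ∀ x z : EuclideanSpace ℝ (Fin d),
      ‖f t x z‖ ≤ K * (1 + ‖x‖) * (1 + ‖z‖))
    -- (A4)
    (L : ℝ) (hL : 0 < L)
    (hA4 : ∀ t ∈ Set.Icc (0:ℝ) (((n:ℝ)+1)*τ), ∀ x₁ x₂ z : EuclideanSpace ℝ (Fin d),
      ‖f t x₁ z - f t x₂ z‖ ≤ L * (1 + ‖z‖) * ‖x₁ - x₂‖) :
    ∃ x : ℝ → EuclideanSpace ℝ (Fin d),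
      ((∀ t ∈ Set.Ico (-τ) (0:ℝ), x t = φ t) ∧
       x 0 = φ 0 ∧
       ContinuousOn x (Set.Icc (0:ℝ) (((n:ℝ)+1)*τ)) ∧
       IntervalIntegrable (fun s => f s (x s) (x (s - τ))) MeasureTheory.volume 0 (((n:ℝ)+1)*τ) ∧
       (∀ t ∈ Set.Icc (0:ℝ) (((n:ℝ)+1)*τ),
          x t = φ 0 + ∫ s in (0:ℝ)..t, f s (x s) (x (s - τ)))) ∧
      (∀ y : ℝ → EuclideanSpace ℝ (Fin d),
        ((∀ t ∈ Set.Ico (-τ) (0:ℝ), y t = φ t) ∧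
         y 0 = φ 0 ∧
         ContinuousOn y (Set.Icc (0:ℝ) (((n:ℝ)+1)*τ)) ∧
         IntervalIntegrable (fun s => f s (y s) (y (s - τ))) MeasureTheory.volume 0 (((n:ℝ)+1)*τ) ∧
         (∀ t ∈ Set.Icc (0:ℝ) (((n:ℝ)+1)*τ),
            y t = φ 0 + ∫ s in (0:ℝ)..t, f s (y s) (y (s - τ)))) →
        ∀ t ∈ Set.Icc (-τ) (((n:ℝ)+1)*τ), y t = x t) := by
  have hIH : ∀ k : ℕ, k ≤ n + 1 → ∃ x : ℝ → EuclideanSpace ℝ (Fin d),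
      (∀ t ∈ Icc (-τ) 0, x t = φ t) ∧ ContinuousOn x (Icc (-τ) (k * τ)) ∧
      IntegrableOn (fun s => f s (x s) (x (s - τ))) (Icc 0 (k * τ)) ∧
      (∀ t ∈ Icc (0:ℝ) (k * τ), x t = φ 0 + ∫ s in (0:ℝ)..t, f s (x s) (x (s - τ))) ∧
      ∀ y : ℝ → EuclideanSpace ℝ (Fin d), (∀ t ∈ Icc (-τ) 0, y t = φ t) →
        ContinuousOn y (Icc (0:ℝ) (k * τ)) →
        (∀ t ∈ Icc (0:ℝ) (k * τ), y t = φ 0 + ∫ s in (0:ℝ)..t, f s (y s) (y (s - τ))) →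
        ∀ t ∈ Icc (-τ) (k * τ), y t = x t := by
    intro k
    induction k with
    | zero =>
      intro _
      refine ⟨φ, fun _ _ => rfl, by simpa using hA1φ, by simp, ?_, ?_⟩
      · intro t ht
        have : t = 0 := by simpa using ht
        simp [this]
      · intro y hy _ _ t ht
        exact hy t (by simpa using ht)
    | succ k ih =>
      intro hk
      obtain ⟨x, hx0, hxc, -, hxeq, hxu⟩ := ih (by omega)
      have hkτ : (0:ℝ) ≤ k * τ := by positivity
      push_cast
      set T : ℝ := ((k:ℝ) + 1) * τ with hTdef
      have hTk : T = k * τ + τ := by rw [hTdef]; ring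
      have hT0 : 0 ≤ T := by linarith
      have hTn : T ≤ ((n:ℝ) + 1) * τ := by
        apply mul_le_mul_of_nonneg_right _ hτ.le
        exact_mod_cast hk
      have hsub : ∀ s ∈ Icc 0 T, s ∈ Icc (0:ℝ) (((n:ℝ)+1)*τ) := fun s hs =>
        ⟨hs.1, hs.2.trans hTn⟩
      have hzc : ContinuousOn (fun s => x (s - τ)) (Icc 0 T) := by
        refine hxc.comp (by fun_prop) fun s hs => ?_
        constructor <;> [linarith [hs.1]; linarith [hs.2]]
      obtain ⟨B, hB⟩ := isCompact_Icc.exists_bound_of_continuousOn hzc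
      have hB0 : 0 ≤ B := (norm_nonneg _).trans (hB 0 ⟨le_rfl, hT0⟩)
      obtain ⟨u, huc, hui, hueq, huu⟩ := ode_exists hT0 (fun s v => f s v (x (s - τ)))
        (fun u hu => cara_meas f (fun t ht => hA1f t (hsub t ht)) hA2 u _ hu hzc)
        (K * (1 + B)) (L * (1 + B)) (by positivity)
        (fun s hs => by
          refine (hA3 s (hsub s hs) _ _).trans ?_
          have := hB s hs
          simp only [norm_zero, add_zero, mul_one]
          gcongr)
        (fun s hs a b => by
          refine (hA4 s (hsub s hs) _ _ _).trans ?_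
          have := hB s hs
          gcongr) (φ 0)
      have hu0 : u 0 = φ 0 := by simpa using hueq 0 ⟨le_rfl, hT0⟩
      -- u agrees with x on [0, kτ]
      let x' : ℝ → EuclideanSpace ℝ (Fin d) := fun t => if t < 0 then φ t else u t
      have hx'neg : ∀ t ∈ Icc (-τ) 0, x' t = φ t := by
        intro t ht
        rcases ht.2.lt_or_eq with h | h
        · simp [x', h]
        · simp [x', h, hu0]
      have hx'pos : ∀ t, 0 ≤ t → x' t = u t := fun t ht => by simp [x', not_lt.2 ht]
      have hux : ∀ t ∈ Icc (0:ℝ) (k * τ), x t = u t := by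
        have hsubk : ∀ s ∈ Icc 0 ((k:ℝ) * τ), s ∈ Icc 0 T := fun s hs =>
          ⟨hs.1, hs.2.trans (by linarith)⟩
        obtain ⟨w, -, -, -, hwu⟩ := ode_exists hkτ (fun s v => f s v (x (s - τ)))
          (fun u hu => cara_meas f (fun t ht => hA1f t (hsub t (hsubk t ht))) hA2 u _ hu
            (hzc.mono hsubk))
          (K * (1 + B)) (L * (1 + B)) (by positivity)
          (fun s hs => by
            refine (hA3 s (hsub s (hsubk s hs)) _ _).trans ?_
            have := hB s (hsubk s hs)
            simp only [norm_zero, add_zero, mul_one]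
            gcongr)
          (fun s hs a b => by
            refine (hA4 s (hsub s (hsubk s hs)) _ _ _).trans ?_
            have := hB s (hsubk s hs)
            gcongr) (φ 0)
        intro t ht
        rw [hwu x (hxc.mono (Icc_subset_Icc_left (by linarith))) hxeq t ht,
          hwu u huc.continuousOn (fun t ht => hueq t (hsubk t ht)) t ht]
      have hx'x : ∀ t ∈ Icc (-τ) (k * τ), x' t = x t := by
        intro t ht
        rcases le_total t 0 with h | h
        · rw [hx'neg t ⟨ht.1, h⟩, hx0 t ⟨ht.1, h⟩]
        · rw [hx'pos t h, hux t ⟨h, ht.2⟩]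
      have hshift : ∀ s ∈ Icc 0 T, s - τ ∈ Icc (-τ) (k * τ) := fun s hs =>
        ⟨by linarith [hs.1], by linarith [hs.2]⟩
      have hfeq : ∀ s ∈ Icc 0 T, f s (u s) (x (s - τ)) = f s (x' s) (x' (s - τ)) :=
        fun s hs => by rw [hx'pos s hs.1, hx'x _ (hshift s hs)]
      refine ⟨x', hx'neg, ?_, ?_, ?_, ?_⟩
      · rw [← Icc_union_Icc_eq_Icc (by linarith : -τ ≤ 0) hT0]
        exact (hA1φ.congr hx'neg).union_of_isClosed
          (huc.continuousOn.congr fun t ht => hx'pos t ht.1) isClosed_Icc isClosed_Icc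
      · exact hui.congr_fun hfeq measurableSet_Icc
      · intro t ht
        rw [hx'pos t ht.1, hueq t ht]
        congr 1
        refine intervalIntegral.integral_congr fun s hs => ?_
        rw [uIcc_of_le ht.1] at hs
        exact hfeq s ⟨hs.1, hs.2.trans ht.2⟩
      · intro y hy0 hyc hyeq
        have hyx := hxu y hy0 (hyc.mono (Icc_subset_Icc_right (by linarith)))
          (fun t ht => hyeq t ⟨ht.1, ht.2.trans (by linarith)⟩)
        have hyu := huu y hyc (fun t ht => by
          rw [hyeq t ht]
          congr 1
          refine intervalIntegral.integral_congr fun s hs => ?_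
          rw [uIcc_of_le ht.1] at hs
          rw [hyx _ (hshift s ⟨hs.1, hs.2.trans ht.2⟩)])
        intro t ht
        rcases le_total t 0 with h | h
        · rw [hy0 t ⟨ht.1, h⟩, hx'neg t ⟨ht.1, h⟩]
        · rw [hx'pos t h, hyu t ⟨h, ht.2⟩]
  obtain ⟨x, hx0, hxc, hxi, hxeq, hxu⟩ := hIH (n + 1) le_rfl
  push_cast at hxc hxi hxeq hxu
  have hT0 : (0:ℝ) ≤ ((n:ℝ)+1)*τ := by positivity
  refine ⟨x, ⟨fun t ht => hx0 t ⟨ht.1, ht.2.le⟩, hx0 0 ⟨by linarith, le_rfl⟩,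
    hxc.mono (Icc_subset_Icc_left (by linarith)), ?_, hxeq⟩, ?_⟩
  · rw [intervalIntegrable_iff_integrableOn_Icc_of_le hT0]
    exact hxi
  · rintro y ⟨hy0, hy00, hyc, -, hyeq⟩
    refine hxu y (fun t ht => ?_) hyc hyeq
    rcases ht.2.lt_or_eq with h | h
    · exact hy0 t ⟨ht.1, h⟩
    · rw [h, hy00]
end

section
/- Under assumptions (A1)–(A4), the unique absolutely continuous solution x of the DDE satisfies, for every j = 0, 1, …, n, the bound sup_{0 ≤ t ≤ τ} |φ_j(t)| ≤ K_j, where φ_j(t) = x(t + jτ), K_{−1} = max_{t ∈ [−τ,0]} |φ(t)|, and K_j = (1 + K_{j−1})(1 + Kτ)·exp((1 + K_{j−1})Kτ). -/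
open Set MeasureTheory intervalIntegral

theorem my_gronwall (a b A c : ℝ) (hab : a ≤ b) (hc : 0 ≤ c) (u : ℝ → ℝ)
    (hu : ContinuousOn u (Set.Icc a b)) (hu0 : ∀ t ∈ Set.Icc a b, 0 ≤ u t)
    (h : ∀ t ∈ Set.Icc a b, u t ≤ A + c * ∫ s in a..t, u s) :
    ∀ t ∈ Set.Icc a b, u t ≤ A * Real.exp (c * (t - a)) := by
  obtain ⟨v, hv, hvu⟩ : ∃ v : ℝ → ℝ, Continuous v ∧ ∀ t ∈ Set.Icc a b, v t = u t := by
    refine ⟨Set.IccExtend hab ((Set.Icc a b).restrict u), ?_, ?_⟩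
    · exact (continuousOn_iff_continuous_restrict.mp hu).Icc_extend'
    · intro t ht
      rw [Set.IccExtend_of_mem _ _ ht]
      rfl
  have hg : ∀ t, HasDerivAt (fun t => A + c * ∫ s in a..t, v s) (c * v t) t := by
    intro t
    exact ((intervalIntegral.integral_hasDerivAt_right (hv.intervalIntegrable _ _)
      (hv.stronglyMeasurableAtFilter _ _) hv.continuousAt).const_mul c).const_add A
  have hle : ∀ t ∈ Set.Icc a b, v t ≤ A + c * ∫ s in a..t, v s := by
    intro t ht
    rw [hvu t ht]
    refine (h t ht).trans_eq ?_
    congr 2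
    apply intervalIntegral.integral_congr
    intro s hs
    rw [Set.uIcc_of_le ht.1] at hs
    exact (hvu s ⟨hs.1, hs.2.trans ht.2⟩).symm
  have hv0 : ∀ t ∈ Set.Icc a b, 0 ≤ v t := fun t ht => by rw [hvu t ht]; exact hu0 t ht
  have hA : 0 ≤ A := by
    have h1 := hle a ⟨le_rfl, hab⟩
    have h2 := hv0 a ⟨le_rfl, hab⟩
    simp at h1
    linarith
  have key := norm_le_gronwallBound_of_norm_deriv_right_le (f := fun t => A + c * ∫ s in a..t, v s)
    (f' := fun t => c * v t) (δ := A) (K := c) (ε := 0) (a := a) (b := b)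
    (fun t _ => (hg t).continuousAt.continuousWithinAt)
    (fun t _ => (hg t).hasDerivWithinAt)
    (by simp [abs_of_nonneg hA])
    (by
      intro t ht
      have ht' : t ∈ Set.Icc a b := ⟨ht.1, ht.2.le⟩
      have h1 := hle t ht'
      have h2 := hv0 t ht'
      rw [Real.norm_of_nonneg (mul_nonneg hc h2), Real.norm_of_nonneg (h2.trans h1), add_zero]
      exact mul_le_mul_of_nonneg_left h1 hc)
  intro t ht
  have h3 := key t ht
  rw [gronwallBound_ε0] at h3
  rw [← hvu t ht]
  exact (hle t ht).trans ((le_abs_self _).trans h3)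

/-- Under (A1)–(A4) the unique absolutely continuous solution `x` of the DDE satisfies, for
every `j = 0,…,n`, `sup_{0 ≤ t ≤ τ} |φ_j(t)| ≤ K_j` where `φ_j(t) = x(t + jτ)`,
`K_{−1} = max_{[−τ,0]} |φ|` and `K_j = (1+K_{j−1})(1+Kτ) exp((1+K_{j−1})Kτ)`.
Here `Kc (j+1)` plays the role of `K_j` and `Kc 0` the role of `K_{−1}`. -/
theorem dde_solution_bound
    (d : ℕ) (n : ℕ) (τ : ℝ) (hτ : 0 < τ)
    (f : ℝ → EuclideanSpace ℝ (Fin d) → EuclideanSpace ℝ (Fin d) → EuclideanSpace ℝ (Fin d))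
    (φ : ℝ → EuclideanSpace ℝ (Fin d))
    -- (A1)
    (hA1f : ∀ t ∈ Set.Icc (0:ℝ) (((n:ℝ)+1)*τ),
      Continuous (fun p : EuclideanSpace ℝ (Fin d) × EuclideanSpace ℝ (Fin d) => f t p.1 p.2))
    (hA1φ : ContinuousOn φ (Set.Icc (-τ) 0))
    -- (A2)
    (hA2 : ∀ x z : EuclideanSpace ℝ (Fin d), Measurable (fun t => f t x z))
    -- (A3)
    (K : ℝ) (hK : 0 < K)
    (hA3 : ∀ t ∈ Set.Icc (0:ℝ) (((n:ℝ)+1)*τ), ∀ x z : EuclideanSpace ℝ (Fin d),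
      ‖f t x z‖ ≤ K * (1 + ‖x‖) * (1 + ‖z‖))
    -- (A4)
    (L : ℝ) (hL : 0 < L)
    (hA4 : ∀ t ∈ Set.Icc (0:ℝ) (((n:ℝ)+1)*τ), ∀ x₁ x₂ z : EuclideanSpace ℝ (Fin d),
      ‖f t x₁ z - f t x₂ z‖ ≤ L * (1 + ‖z‖) * ‖x₁ - x₂‖)
    -- `x` is the (unique) absolutely continuous solution of the DDE
    (x : ℝ → EuclideanSpace ℝ (Fin d))
    (hx_init : ∀ t ∈ Set.Ico (-τ) (0:ℝ), x t = φ t)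
    (hx_zero : x 0 = φ 0)
    (hx_cont : ContinuousOn x (Set.Icc (0:ℝ) (((n:ℝ)+1)*τ)))
    (hx_int : IntervalIntegrable (fun s => f s (x s) (x (s - τ)))
      MeasureTheory.volume 0 (((n:ℝ)+1)*τ))
    (hx_eq : ∀ t ∈ Set.Icc (0:ℝ) (((n:ℝ)+1)*τ),
      x t = φ 0 + ∫ s in (0:ℝ)..t, f s (x s) (x (s - τ)))
    -- the constants `K_{-1}, K_0, …, K_n` (shifted by one)
    (Kc : ℕ → ℝ)
    (hKc0 : Kc 0 = sSup ((fun t => ‖φ t‖) '' Set.Icc (-τ) 0))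
    (hKcs : ∀ j : ℕ,
      Kc (j+1) = (1 + Kc j) * (1 + K * τ) * Real.exp ((1 + Kc j) * K * τ)) :
    ∀ j : ℕ, j ≤ n → ∀ t ∈ Set.Icc (0:ℝ) τ, ‖x (t + (j:ℝ) * τ)‖ ≤ Kc (j+1) := by
  have hφ0 : ∀ t ∈ Set.Icc (-τ) (0:ℝ), ‖φ t‖ ≤ Kc 0 := by
    intro t ht
    rw [hKc0]
    exact le_csSup (isCompact_Icc.image_of_continuousOn hA1φ.norm).bddAbove ⟨t, ht, rfl⟩
  have hKnn : ∀ j, 0 ≤ Kc j := by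
    intro j
    induction j with
    | zero => exact (norm_nonneg _).trans (hφ0 0 ⟨by linarith, le_rfl⟩)
    | succ j ih => rw [hKcs]; positivity
  have main : ∀ j : ℕ, j ≤ n + 1 →
      ∀ s ∈ Set.Icc ((j:ℝ) * τ - τ) ((j:ℝ) * τ), ‖x s‖ ≤ Kc j := by
    intro j
    induction j with
    | zero =>
      intro _ s hs
      simp only [Nat.cast_zero, zero_mul, zero_sub] at hs
      rcases hs.2.lt_or_eq with h | h
      · rw [hx_init s ⟨hs.1, h⟩]; exact hφ0 s hs
      · rw [h, hx_zero]; exact hφ0 0 ⟨by linarith, le_rfl⟩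
    | succ j ih =>
      intro hj s hs
      have ihj := ih (by omega)
      have hjn : (j:ℝ) ≤ n := by exact_mod_cast (by omega : j ≤ n)
      have hj0 : (0:ℝ) ≤ (j:ℝ) * τ := by positivity
      have hend : (j:ℝ) * τ + τ ≤ ((n:ℝ)+1)*τ := by nlinarith
      have hs' : s ∈ Set.Icc ((j:ℝ) * τ) ((j:ℝ) * τ + τ) := by
        push_cast at hs
        constructor <;> [have := hs.1; have := hs.2] <;> linarith
      have hsub : Set.Icc ((j:ℝ) * τ) ((j:ℝ) * τ + τ) ⊆ Set.Icc (0:ℝ) (((n:ℝ)+1)*τ) :=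
        Set.Icc_subset_Icc hj0 hend
      have hKj := hKnn j
      have hcont : ContinuousOn (fun t => 1 + ‖x t‖) (Set.Icc ((j:ℝ) * τ) ((j:ℝ) * τ + τ)) :=
        continuousOn_const.add (hx_cont.mono hsub).norm
      have hg := my_gronwall ((j:ℝ) * τ) ((j:ℝ) * τ + τ) (1 + Kc j) ((1 + Kc j) * K)
        (by linarith) (by positivity) (fun t => 1 + ‖x t‖) hcont
        (fun t _ => by positivity) (by
          intro t ht
          have hja : (j:ℝ) * τ ∈ Set.Icc (0:ℝ) (((n:ℝ)+1)*τ) := hsub ⟨le_rfl, by linarith⟩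
          have ht' := hsub ht
          have hi : ∀ p ∈ Set.Icc (0:ℝ) (((n:ℝ)+1)*τ), ∀ q ∈ Set.Icc (0:ℝ) (((n:ℝ)+1)*τ),
              IntervalIntegrable (fun s => f s (x s) (x (s - τ))) volume p q := by
            intro p hp q hq
            refine hx_int.mono_set ?_
            rw [Set.uIcc_of_le (hj0.trans (by linarith))]
            exact Set.ordConnected_Icc.uIcc_subset hp hq
          have hz : (0:ℝ) ∈ Set.Icc (0:ℝ) (((n:ℝ)+1)*τ) := ⟨le_rfl, hja.1.trans hja.2⟩
          have hxt : x t = x ((j:ℝ) * τ) + ∫ s in ((j:ℝ) * τ)..t, f s (x s) (x (s - τ)) := by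
            rw [hx_eq t ht', hx_eq _ hja, add_assoc,
              intervalIntegral.integral_add_adjacent_intervals (hi _ hz _ hja) (hi _ hja _ ht')]
          have hxj : ‖x ((j:ℝ) * τ)‖ ≤ Kc j := ihj _ ⟨by linarith, le_rfl⟩
          have hint : ‖∫ s in ((j:ℝ) * τ)..t, f s (x s) (x (s - τ))‖ ≤
              ∫ s in ((j:ℝ) * τ)..t, (1 + Kc j) * K * (1 + ‖x s‖) := by
            apply intervalIntegral.norm_integral_le_of_norm_le ht.1
            · refine Filter.Eventually.of_forall ?_
              intro r hr
              have hr' : r ∈ Set.Icc (0:ℝ) (((n:ℝ)+1)*τ) :=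
                ⟨hj0.trans hr.1.le, hr.2.trans ht'.2⟩
              have hb : ‖x (r - τ)‖ ≤ Kc j :=
                ihj _ ⟨by linarith [hr.1], by linarith [hr.2, ht.2]⟩
              calc _ ≤ K * (1 + ‖x r‖) * (1 + ‖x (r - τ)‖) := hA3 r hr' _ _
                _ ≤ K * (1 + ‖x r‖) * (1 + Kc j) := by gcongr
                _ = _ := by ring
            · apply ContinuousOn.intervalIntegrable
              rw [Set.uIcc_of_le ht.1]
              exact continuousOn_const.mul (hcont.mono (Set.Icc_subset_Icc le_rfl ht.2))
          rw [intervalIntegral.integral_const_mul] at hint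
          have := norm_add_le (x ((j:ℝ) * τ)) (∫ s in ((j:ℝ) * τ)..t, f s (x s) (x (s - τ)))
          rw [← hxt] at this
          show 1 + ‖x t‖ ≤ _
          linarith) s hs'
      rw [hKcs]
      have h1 : Real.exp ((1 + Kc j) * K * (s - (j:ℝ) * τ)) ≤ Real.exp ((1 + Kc j) * K * τ) := by
        apply Real.exp_le_exp.mpr
        apply mul_le_mul_of_nonneg_left _ (by positivity)
        linarith [hs'.2]
      have hg' : 1 + ‖x s‖ ≤ (1 + Kc j) * Real.exp ((1 + Kc j) * K * τ) :=
        le_trans hg (by gcongr)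
      have h2 : (1 + Kc j) * Real.exp ((1 + Kc j) * K * τ) ≤
          (1 + Kc j) * (1 + K * τ) * Real.exp ((1 + Kc j) * K * τ) := by
        have : 0 ≤ (1 + Kc j) * Real.exp ((1 + Kc j) * K * τ) * (K * τ) := by positivity
        nlinarith
      linarith
  intro j hj t ht
  apply main (j+1) (by omega)
  push_cast
  constructor <;> [have := ht.1; have := ht.2] <;> linarith
end

section
/- Under assumptions (A1)–(A4), the segments φ_j(t) = x(t + jτ) of the unique solution x of the DDE are Lipschitz continuous: for all j = 0, 1, …, n and all t, s ∈ [0, τ], |φ_j(t) − φ_j(s)| ≤ (1 + K_{j−1})(1 + K_j)·K·|t − s|, where K_{−1} = max_{t ∈ [−τ,0]} |φ(t)| and K_j = (1 + K_{j−1})(1 + Kτ)·exp((1 + K_{j−1})Kτ). -/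
open Set MeasureTheory intervalIntegral

lemma gron_aux (u : ℝ → ℝ) (a b C M : ℝ) (hab : a ≤ b) (hM : 0 ≤ M)
    (hu : ContinuousOn u (Set.Icc a b)) (hu0 : ∀ t ∈ Set.Icc a b, 0 ≤ u t) (hC : 0 ≤ C)
    (h : ∀ t ∈ Set.Icc a b, u t ≤ C + M * ∫ s in a..t, u s) :
    ∀ t ∈ Set.Icc a b, u t ≤ C * Real.exp (M * (t - a)) := by
  set v : ℝ → ℝ := fun t => u (Set.projIcc a b hab t) with hv
  have hvc : Continuous v := by
    have := (continuousOn_iff_continuous_domRestrict.1 hu).comp (continuous_projIcc (h := hab))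
    exact this
  have hv0 : ∀ t, 0 ≤ v t := fun t => hu0 _ (Set.projIcc a b hab t).2
  have hvu : ∀ t ∈ Set.Icc a b, v t = u t := by
    intro t ht
    simp only [hv]
    rw [Set.projIcc_of_mem hab ht]
  have hint : ∀ t ∈ Set.Icc a b, ∫ s in a..t, u s = ∫ s in a..t, v s := by
    intro t ht
    apply intervalIntegral.integral_congr
    intro s hs
    rw [Set.uIcc_of_le ht.1] at hs
    exact (hvu s ⟨hs.1, hs.2.trans ht.2⟩).symm
  set G : ℝ → ℝ := fun t => C + M * ∫ s in a..t, v s with hG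
  have hd : ∀ t, HasDerivAt G (M * v t) t := by
    intro t
    exact ((intervalIntegral.integral_hasDerivAt_right (hvc.intervalIntegrable _ _)
      (hvc.stronglyMeasurableAtFilter _ _) hvc.continuousAt).const_mul M).const_add C
  have hvG : ∀ t ∈ Set.Icc a b, v t ≤ G t := by
    intro t ht
    rw [hvu t ht]
    have := h t ht
    rw [hint t ht] at this
    exact this
  have key := norm_le_gronwallBound_of_norm_deriv_right_le (f := G) (f' := fun t => M * v t)
    (δ := C) (K := M) (ε := 0) (a := a) (b := b)
    (fun t _ => (hd t).continuousAt.continuousWithinAt)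
    (fun t _ => (hd t).hasDerivWithinAt)
    (by simp [hG, abs_of_nonneg hC])
    (by
      intro t ht
      have ht' : t ∈ Set.Icc a b := ⟨ht.1, ht.2.le⟩
      rw [Real.norm_of_nonneg (mul_nonneg hM (hv0 t)), add_zero]
      exact mul_le_mul_of_nonneg_left ((hvG t ht').trans (Real.le_norm_self _)) hM)
  intro t ht
  have h1 := key t ht
  rw [gronwallBound_ε0] at h1
  rw [← hvu t ht]
  exact ((hvG t ht).trans (Real.le_norm_self _)).trans h1

/-- Under (A1)–(A4) the segments `φ_j(t) = x(t + jτ)` of the unique solution of the DDE are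
Lipschitz: `|φ_j(t) − φ_j(s)| ≤ (1+K_{j−1})(1+K_j) K |t−s|` for `t, s ∈ [0,τ]`, where
`K_{−1} = max_{[−τ,0]} |φ|` and `K_j = (1+K_{j−1})(1+Kτ) exp((1+K_{j−1})Kτ)`.
Here `Kc (j+1)` plays the role of `K_j` and `Kc 0` the role of `K_{−1}`. -/
theorem dde_solution_lipschitz
    (d : ℕ) (n : ℕ) (τ : ℝ) (hτ : 0 < τ)
    (f : ℝ → EuclideanSpace ℝ (Fin d) → EuclideanSpace ℝ (Fin d) → EuclideanSpace ℝ (Fin d))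
    (φ : ℝ → EuclideanSpace ℝ (Fin d))
    -- (A1)
    (hA1f : ∀ t ∈ Set.Icc (0:ℝ) (((n:ℝ)+1)*τ),
      Continuous (fun p : EuclideanSpace ℝ (Fin d) × EuclideanSpace ℝ (Fin d) => f t p.1 p.2))
    (hA1φ : ContinuousOn φ (Set.Icc (-τ) 0))
    -- (A2)
    (hA2 : ∀ x z : EuclideanSpace ℝ (Fin d), Measurable (fun t => f t x z))
    -- (A3)
    (K : ℝ) (hK : 0 < K)
    (hA3 : ∀ t ∈ Set.Icc (0:ℝ) (((n:ℝ)+1)*τ), ∀ x z : EuclideanSpace ℝ (Fin d),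
      ‖f t x z‖ ≤ K * (1 + ‖x‖) * (1 + ‖z‖))
    -- (A4)
    (L : ℝ) (hL : 0 < L)
    (hA4 : ∀ t ∈ Set.Icc (0:ℝ) (((n:ℝ)+1)*τ), ∀ x₁ x₂ z : EuclideanSpace ℝ (Fin d),
      ‖f t x₁ z - f t x₂ z‖ ≤ L * (1 + ‖z‖) * ‖x₁ - x₂‖)
    -- `x` is the (unique) absolutely continuous solution of the DDE
    (x : ℝ → EuclideanSpace ℝ (Fin d))
    (hx_init : ∀ t ∈ Set.Ico (-τ) (0:ℝ), x t = φ t)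
    (hx_zero : x 0 = φ 0)
    (hx_cont : ContinuousOn x (Set.Icc (0:ℝ) (((n:ℝ)+1)*τ)))
    (hx_int : IntervalIntegrable (fun s => f s (x s) (x (s - τ)))
      MeasureTheory.volume 0 (((n:ℝ)+1)*τ))
    (hx_eq : ∀ t ∈ Set.Icc (0:ℝ) (((n:ℝ)+1)*τ),
      x t = φ 0 + ∫ s in (0:ℝ)..t, f s (x s) (x (s - τ)))
    -- the constants `K_{-1}, K_0, …, K_n` (shifted by one)
    (Kc : ℕ → ℝ)
    (hKc0 : Kc 0 = sSup ((fun t => ‖φ t‖) '' Set.Icc (-τ) 0))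
    (hKcs : ∀ j : ℕ,
      Kc (j+1) = (1 + Kc j) * (1 + K * τ) * Real.exp ((1 + Kc j) * K * τ)) :
    ∀ j : ℕ, j ≤ n → ∀ t ∈ Set.Icc (0:ℝ) τ, ∀ s ∈ Set.Icc (0:ℝ) τ,
      ‖x (t + (j:ℝ) * τ) - x (s + (j:ℝ) * τ)‖ ≤
        (1 + Kc j) * (1 + Kc (j+1)) * K * |t - s| := by
  set T : ℝ := ((n:ℝ)+1)*τ with hT
  set g : ℝ → EuclideanSpace ℝ (Fin d) := fun s => f s (x s) (x (s - τ)) with hg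
  have hT0 : 0 ≤ T := by positivity
  have hgi : ∀ s ∈ Set.Icc (0:ℝ) T, ∀ t ∈ Set.Icc (0:ℝ) T, IntervalIntegrable g volume s t := by
    intro s hs t ht
    apply hx_int.mono_set
    rw [Set.uIcc_of_le hT0]
    exact Set.uIcc_subset_Icc hs ht
  have hdiff : ∀ s ∈ Set.Icc (0:ℝ) T, ∀ t ∈ Set.Icc (0:ℝ) T, x t - x s = ∫ r in s..t, g r := by
    intro s hs t ht
    have h0 : (0:ℝ) ∈ Set.Icc (0:ℝ) T := ⟨le_rfl, hT0⟩
    rw [hx_eq t ht, hx_eq s hs, add_sub_add_left_eq_sub]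
    exact intervalIntegral.integral_interval_sub_left (hgi 0 h0 t ht) (hgi 0 h0 s hs)
  have hsub : ∀ j : ℕ, j ≤ n → ∀ t ∈ Set.Icc ((j:ℝ)*τ) ((j:ℝ)*τ+τ), t ∈ Set.Icc (0:ℝ) T := by
    intro j hj t ht
    have h1 : (j:ℝ) ≤ n := by exact_mod_cast hj
    have h2 : (j:ℝ) * τ ≤ n * τ := mul_le_mul_of_nonneg_right h1 hτ.le
    have h3 : (0:ℝ) ≤ (j:ℝ) * τ := by positivity
    constructor
    · exact h3.trans ht.1
    · have := ht.2
      rw [hT]; linarith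
  have hB : ∀ j : ℕ, j ≤ n + 1 → 0 ≤ Kc j ∧
      ∀ t ∈ Set.Icc ((j:ℝ)*τ - τ) ((j:ℝ)*τ), ‖x t‖ ≤ Kc j := by
    intro j
    induction j with
    | zero =>
      intro _
      have hbd : BddAbove ((fun t => ‖φ t‖) '' Set.Icc (-τ) 0) :=
        (isCompact_Icc.image_of_continuousOn hA1φ.norm).bddAbove
      have hle : ∀ t ∈ Set.Icc (-τ) 0, ‖φ t‖ ≤ Kc 0 := by
        intro t ht
        rw [hKc0]
        exact le_csSup hbd ⟨t, ht, rfl⟩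
      refine ⟨(norm_nonneg _).trans (hle 0 ⟨by linarith, le_rfl⟩), ?_⟩
      intro t ht
      simp only [Nat.cast_zero, zero_mul, zero_sub] at ht
      rcases ht.2.lt_or_eq with h | h
      · rw [hx_init t ⟨ht.1, h⟩]; exact hle t ht
      · subst h; rw [hx_zero]; exact hle _ ht
    | succ j ih =>
      intro hj
      have hjn : j ≤ n := by omega
      obtain ⟨hk, hb⟩ := ih (by omega)
      have hKτ : 0 < K * τ := by positivity
      refine ⟨by rw [hKcs]; positivity, ?_⟩
      have hcont : ContinuousOn x (Set.Icc ((j:ℝ)*τ) ((j:ℝ)*τ+τ)) :=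
        hx_cont.mono (hsub j hjn)
      have hM : 0 ≤ (1 + Kc j) * K := by positivity
      have hg1 := gron_aux (fun t => 1 + ‖x t‖) ((j:ℝ)*τ) ((j:ℝ)*τ+τ) (1 + Kc j)
        ((1 + Kc j) * K) (by linarith) hM (continuousOn_const.add hcont.norm)
        (fun t _ => by positivity) (by positivity)
        (by
          intro t ht
          have ha : (j:ℝ)*τ ∈ Set.Icc ((j:ℝ)*τ) ((j:ℝ)*τ+τ) := ⟨le_rfl, by linarith⟩
          have h1 := hdiff _ (hsub j hjn _ ha) t (hsub j hjn t ht)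
          have h2 : ‖x t‖ ≤ ‖x ((j:ℝ)*τ)‖ + ‖∫ r in ((j:ℝ)*τ)..t, g r‖ := by
            rw [← h1]
            simpa using norm_add_le (x ((j:ℝ)*τ)) (x t - x ((j:ℝ)*τ))
          have h3 : ‖x ((j:ℝ)*τ)‖ ≤ Kc j := hb _ ⟨by linarith, le_rfl⟩
          have h4 : ‖∫ r in ((j:ℝ)*τ)..t, g r‖ ≤
              ∫ r in ((j:ℝ)*τ)..t, (1 + Kc j) * K * (1 + ‖x r‖) := by
            apply intervalIntegral.norm_integral_le_of_norm_le ht.1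
            · refine Filter.Eventually.of_forall ?_
              intro r hr
              have hr' : r ∈ Set.Icc ((j:ℝ)*τ) ((j:ℝ)*τ+τ) := ⟨hr.1.le, hr.2.trans ht.2⟩
              have h5 := hA3 r (hsub j hjn r hr') (x r) (x (r - τ))
              have h6 : ‖x (r - τ)‖ ≤ Kc j :=
                hb _ ⟨by linarith [hr'.1], by linarith [hr'.2]⟩
              calc ‖g r‖ ≤ K * (1 + ‖x r‖) * (1 + ‖x (r - τ)‖) := h5
                _ ≤ K * (1 + ‖x r‖) * (1 + Kc j) := by gcongr
                _ = _ := by ring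
            · apply ContinuousOn.intervalIntegrable
              rw [Set.uIcc_of_le ht.1]
              exact continuousOn_const.mul (continuousOn_const.add
                (hcont.norm.mono (Set.Icc_subset_Icc le_rfl ht.2)))
          rw [intervalIntegral.integral_const_mul] at h4
          linarith)
      intro t ht
      have hc : ((j+1:ℕ):ℝ) * τ = (j:ℝ)*τ + τ := by push_cast; ring
      rw [hc] at ht
      have ht' : t ∈ Set.Icc ((j:ℝ)*τ) ((j:ℝ)*τ+τ) := ⟨by linarith [ht.1], ht.2⟩
      have h1 := hg1 t ht'
      have h2 : Real.exp ((1 + Kc j) * K * (t - (j:ℝ)*τ)) ≤ Real.exp ((1 + Kc j) * K * τ) := by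
        apply Real.exp_le_exp.2
        apply mul_le_mul_of_nonneg_left _ hM
        linarith [ht'.2]
      have h3 : (1 + Kc j) * Real.exp ((1 + Kc j) * K * (t - (j:ℝ)*τ)) ≤
          (1 + Kc j) * (1 + K * τ) * Real.exp ((1 + Kc j) * K * τ) := by
        apply mul_le_mul _ h2 (Real.exp_pos _).le (by positivity)
        nlinarith
      rw [hKcs]

      linarith
  intro j hj t ht s hs
  obtain ⟨hk, hb⟩ := hB j (by omega)
  obtain ⟨hk', hb'⟩ := hB (j+1) (by omega)
  have hc : ((j+1:ℕ):ℝ) * τ = (j:ℝ)*τ + τ := by push_cast; ring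
  rw [hc] at hb'
  have ht' : t + (j:ℝ)*τ ∈ Set.Icc ((j:ℝ)*τ) ((j:ℝ)*τ+τ) :=
    ⟨by linarith [ht.1], by linarith [ht.2]⟩
  have hs' : s + (j:ℝ)*τ ∈ Set.Icc ((j:ℝ)*τ) ((j:ℝ)*τ+τ) :=
    ⟨by linarith [hs.1], by linarith [hs.2]⟩
  rw [hdiff _ (hsub j hj _ hs') _ (hsub j hj _ ht')]
  have h := intervalIntegral.norm_integral_le_of_norm_le_const (f := g)
    (a := s + (j:ℝ)*τ) (b := t + (j:ℝ)*τ) (C := (1 + Kc j) * (1 + Kc (j+1)) * K) (by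
      intro r hr
      have hr' : r ∈ Set.Icc ((j:ℝ)*τ) ((j:ℝ)*τ+τ) :=
        Set.uIcc_subset_Icc hs' ht' (Set.uIoc_subset_uIcc hr)
      have h5 := hA3 r (hsub j hj r hr') (x r) (x (r - τ))
      have h6 : ‖x (r - τ)‖ ≤ Kc j :=
        hb _ ⟨by linarith [hr'.1], by linarith [hr'.2]⟩
      have h7 : ‖x r‖ ≤ Kc (j+1) := hb' _ ⟨by linarith [hr'.1], hr'.2⟩
      calc ‖g r‖ ≤ K * (1 + ‖x r‖) * (1 + ‖x (r - τ)‖) := h5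
        _ ≤ K * (1 + Kc (j+1)) * (1 + Kc j) := by gcongr
        _ = _ := by ring)
  rwa [add_sub_add_right_eq_sub] at h
end

section
/- Under assumptions (A1), (A2) and (A3'), if the initial condition is constant, φ(t) = x₀ for all t ∈ [−τ, 0], then the function t ↦ g_0(t, φ_0(t)) is γ-Hölder continuous on [0, τ]: there exists C ∈ (0,∞) such that |g_0(s, φ_0(s)) − g_0(t, φ_0(t))| ≤ C|s − t|^γ for all s, t ∈ [0, τ]. -/
open Set MeasureTheory intervalIntegral

/-- Under (A1), (A2), (A3'), if the initial condition is constant, `φ ≡ x₀` on `[−τ,0]`, then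
`t ↦ g_0(t, φ_0(t))` is `γ`-Hölder continuous on `[0,τ]`: there is `C ∈ (0,∞)` with
`|g_0(s,φ_0(s)) − g_0(t,φ_0(t))| ≤ C |s−t|^γ` for all `s, t ∈ [0,τ]`. -/
theorem g0_holder_constant_initial
    (d : ℕ) (n : ℕ) (τ : ℝ) (hτ : 0 < τ)
    (f : ℝ → EuclideanSpace ℝ (Fin d) → EuclideanSpace ℝ (Fin d) → EuclideanSpace ℝ (Fin d))
    (φ : ℝ → EuclideanSpace ℝ (Fin d))
    -- (A1)
    (hA1f : ∀ t ∈ Set.Icc (0:ℝ) (((n:ℝ)+1)*τ),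
      Continuous (fun p : EuclideanSpace ℝ (Fin d) × EuclideanSpace ℝ (Fin d) => f t p.1 p.2))
    (hA1φ : ContinuousOn φ (Set.Icc (-τ) 0))
    -- (A2)
    (hA2 : ∀ x z : EuclideanSpace ℝ (Fin d), Measurable (fun t => f t x z))
    -- (A3')
    (Kb L α γ : ℝ) (hKb : 0 ≤ Kb) (hL : 0 ≤ L)
    (hα : α ∈ Set.Ioc (0:ℝ) 1) (hγ : γ ∈ Set.Ioc (0:ℝ) 1)
    (hf0 : ∀ t ∈ Set.Icc (0:ℝ) (((n:ℝ)+1)*τ), ‖f t 0 0‖ ≤ Kb)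
    (hfxz : ∀ t ∈ Set.Icc (0:ℝ) (((n:ℝ)+1)*τ),
      ∀ x₁ x₂ z₁ z₂ : EuclideanSpace ℝ (Fin d),
        ‖f t x₁ z₁ - f t x₂ z₂‖ ≤ L * (‖x₁ - x₂‖ + ‖z₁ - z₂‖ ^ α))
    (hft : ∀ t₁ ∈ Set.Icc (0:ℝ) (((n:ℝ)+1)*τ), ∀ t₂ ∈ Set.Icc (0:ℝ) (((n:ℝ)+1)*τ),
      ∀ x z : EuclideanSpace ℝ (Fin d),
        ‖f t₁ x z - f t₂ x z‖ ≤ L * (1 + ‖x‖ + ‖z‖) * |t₁ - t₂| ^ γ)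
    (hφLip : ∀ s ∈ Set.Icc (-τ) (0:ℝ), ∀ t ∈ Set.Icc (-τ) (0:ℝ),
      ‖φ t - φ s‖ ≤ L * |t - s|)
    -- `x` is the (unique) absolutely continuous solution of the DDE
    (x : ℝ → EuclideanSpace ℝ (Fin d))
    (hx_init : ∀ t ∈ Set.Ico (-τ) (0:ℝ), x t = φ t)
    (hx_zero : x 0 = φ 0)
    (hx_cont : ContinuousOn x (Set.Icc (0:ℝ) (((n:ℝ)+1)*τ)))
    (hx_int : IntervalIntegrable (fun s => f s (x s) (x (s - τ)))
      MeasureTheory.volume 0 (((n:ℝ)+1)*τ))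
    (hx_eq : ∀ t ∈ Set.Icc (0:ℝ) (((n:ℝ)+1)*τ),
      x t = φ 0 + ∫ s in (0:ℝ)..t, f s (x s) (x (s - τ)))
    -- `φprev j` is the delayed segment `φ_{j−1}` and `g j` the right-hand side `g_j`
    (φprev : ℕ → ℝ → EuclideanSpace ℝ (Fin d))
    (hφprev0 : ∀ t, φprev 0 t = φ (t - τ))
    (hφprevs : ∀ j : ℕ, 1 ≤ j → ∀ t, φprev j t = x (t + ((j:ℝ) - 1) * τ))
    (g : ℕ → ℝ → EuclideanSpace ℝ (Fin d) → EuclideanSpace ℝ (Fin d))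
    (hg : ∀ (j : ℕ) (t : ℝ) (y : EuclideanSpace ℝ (Fin d)),
      g j t y = f (t + (j:ℝ) * τ) y (φprev j t))
    (x₀ : EuclideanSpace ℝ (Fin d))
    (hφconst : ∀ t ∈ Set.Icc (-τ) (0:ℝ), φ t = x₀) :
    ∃ C : ℝ, 0 < C ∧
      ∀ s ∈ Set.Icc (0:ℝ) τ, ∀ t ∈ Set.Icc (0:ℝ) τ,
        ‖g 0 s (x s) - g 0 t (x t)‖ ≤ C * |s - t| ^ γ := by
  obtain ⟨hα0, hα1⟩ := hα
  obtain ⟨hγ0, hγ1⟩ := hγ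
  have hsub : ∀ t ∈ Set.Icc (0:ℝ) τ, t ∈ Set.Icc (0:ℝ) (((n:ℝ)+1)*τ) := by
    intro t ht
    have hn : (0:ℝ) ≤ (n:ℝ) * τ := by positivity
    exact ⟨ht.1, by nlinarith [ht.2]⟩
  obtain ⟨M, hM⟩ := isCompact_Icc.exists_bound_of_continuousOn hx_cont
  have hT : (0:ℝ) ≤ ((n:ℝ)+1)*τ := by positivity
  have hM0 : 0 ≤ M := (norm_nonneg _).trans (hM 0 ⟨le_rfl, hT⟩)
  have hdel : ∀ t ∈ Set.Icc (0:ℝ) τ, φ (t - τ) = x₀ := fun t ht =>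
    hφconst _ ⟨by linarith [ht.1], by linarith [ht.2]⟩
  have hxdel : ∀ t ∈ Set.Icc (0:ℝ) τ, x (t - τ) = x₀ := by
    intro t ht
    rcases lt_or_eq_of_le ht.2 with h | h
    · rw [hx_init _ ⟨by linarith [ht.1], by linarith⟩, hdel t ht]
    · rw [h, sub_self, hx_zero]
      exact hφconst 0 ⟨by linarith, le_rfl⟩
  have hgeq : ∀ t ∈ Set.Icc (0:ℝ) τ, g 0 t (x t) = f t (x t) x₀ := by
    intro t ht
    rw [hg, hφprev0, hdel t ht]
    simp
  obtain ⟨B, hB⟩ : ∃ B, B = Kb + L * (M + ‖x₀‖ ^ α) := ⟨_, rfl⟩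
  have hB0 : 0 ≤ B := by rw [hB]; positivity
  have hbd : ∀ t ∈ Set.Icc (0:ℝ) τ, ‖f t (x t) (x (t - τ))‖ ≤ B := by
    intro t ht
    rw [hxdel t ht, hB]
    have h1 := hfxz t (hsub t ht) (x t) 0 x₀ 0
    have h2 := hf0 t (hsub t ht)
    have h3 := hM t (hsub t ht)
    rw [sub_zero, sub_zero] at h1
    have h4 := norm_add_le (f t (x t) x₀ - f t 0 0) (f t 0 0)
    rw [sub_add_cancel] at h4
    have h5 : L * (‖x t‖ + ‖x₀‖ ^ α) ≤ L * (M + ‖x₀‖ ^ α) := by gcongr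
    linarith
  have hint : ∀ t ∈ Set.Icc (0:ℝ) τ, IntervalIntegrable (fun s => f s (x s) (x (s - τ)))
      MeasureTheory.volume 0 t := by
    intro t ht
    refine hx_int.mono_set ?_
    rw [Set.uIcc_of_le ht.1, Set.uIcc_of_le hT]
    exact Set.Icc_subset_Icc le_rfl (hsub t ht).2
  have hlip : ∀ s ∈ Set.Icc (0:ℝ) τ, ∀ t ∈ Set.Icc (0:ℝ) τ, ‖x s - x t‖ ≤ B * |s - t| := by
    intro s hs t ht
    rw [hx_eq s (hsub s hs), hx_eq t (hsub t ht), add_sub_add_left_eq_sub,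
      intervalIntegral.integral_interval_sub_left (hint s hs) (hint t ht)]
    refine intervalIntegral.norm_integral_le_of_norm_le_const ?_
    intro u hu
    refine hbd u ?_
    have := Set.uIcc_subset_Icc ht hs
    exact this (Set.uIoc_subset_uIcc hu)
  refine ⟨L * (1 + M + ‖x₀‖) + L * B * τ ^ (1 - γ) + 1, by positivity, ?_⟩
  intro s hs t ht
  rw [hgeq s hs, hgeq t ht]
  have h1 := hft s (hsub s hs) t (hsub t ht) (x s) x₀
  have h2 := hfxz t (hsub t ht) (x s) (x t) x₀ x₀
  rw [sub_self, norm_zero, Real.zero_rpow hα0.ne', add_zero] at h2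
  have h3 := hlip s hs t ht
  have h4 : |s - t| ≤ τ ^ (1 - γ) * |s - t| ^ γ := by
    have h5 : |s - t| ≤ τ := by
      rw [abs_le]; constructor <;> linarith [hs.1, hs.2, ht.1, ht.2]
    have h6 : |s - t| = |s - t| ^ (1 - γ) * |s - t| ^ γ := by
      rw [← Real.rpow_add' (abs_nonneg _) (by norm_num)]
      simp
    have h7 : |s - t| ^ (1 - γ) ≤ τ ^ (1 - γ) :=
      Real.rpow_le_rpow (abs_nonneg _) h5 (by linarith)
    calc |s - t| = |s - t| ^ (1 - γ) * |s - t| ^ γ := h6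
      _ ≤ _ := by gcongr
  have hp : 0 ≤ |s - t| ^ γ := by positivity
  have hMs := hM s (hsub s hs)
  calc ‖f s (x s) x₀ - f t (x t) x₀‖
      ≤ ‖f s (x s) x₀ - f t (x s) x₀‖ + ‖f t (x s) x₀ - f t (x t) x₀‖ :=
        norm_sub_le_norm_sub_add_norm_sub _ _ _
    _ ≤ L * (1 + ‖x s‖ + ‖x₀‖) * |s - t| ^ γ + L * ‖x s - x t‖ := add_le_add h1 h2
    _ ≤ L * (1 + M + ‖x₀‖) * |s - t| ^ γ + L * (B * (τ ^ (1 - γ) * |s - t| ^ γ)) := by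
        have h8 : ‖x s - x t‖ ≤ B * (τ ^ (1 - γ) * |s - t| ^ γ) :=
          h3.trans (mul_le_mul_of_nonneg_left h4 hB0)
        gcongr
    _ ≤ _ := by nlinarith
end

section
/- Let φ_{−1}(t) = φ(t−τ) for t ∈ [0,τ], and suppose φ_0, φ_1, …, φ_n : [0,τ] → ℝ^d are absolutely continuous functions satisfying the recursive initial value problems φ_j'(t) = g_j(t, φ_j(t)) for almost every t ∈ [0,τ] with φ_j(0) = φ_{j−1}(τ), where g_j(t,y) = f(t + jτ, y, φ_{j−1}(t)). Then the function x : [−τ, (n+1)τ] → ℝ^d defined by x(t) = Σ_{j=−1}^n φ_j(t − jτ)·1_{[jτ,(j+1)τ)}(t) for t < (n+1)τ and x((n+1)τ) = φ_n(τ) is absolutely continuous on [0,(n+1)τ] and solves the delay differential equation: x(t) = φ(t) for t ∈ [−τ,0) and x'(t) = f(t, x(t), x(t−τ)) for almost every t ∈ [0,(n+1)τ]. -/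
open Set MeasureTheory intervalIntegral

/-- Equivalent piecewise representation of the DDE solution: if `φ_0, …, φ_n` are absolutely
continuous solutions of the recursive initial value problems `φ_j' = g_j(·, φ_j)`,
`φ_j(0) = φ_{j−1}(τ)` (in integral form), where `g_j(t,y) = f(t + jτ, y, φ_{j−1}(t))` and
`φ_{−1}(t) = φ(t−τ)`, then the concatenation
`x(t) = Σ_{j=−1}^n φ_j(t − jτ) 1_{[jτ,(j+1)τ)}(t)`, `x((n+1)τ) = φ_n(τ)` is absolutely
continuous on `[0,(n+1)τ]` and solves the DDE. Here `Φ (j+1)` plays the role of `φ_j` and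
`Φ 0` the role of `φ_{−1}`. -/
theorem dde_piecewise_representation
    (d : ℕ) (n : ℕ) (τ : ℝ) (hτ : 0 < τ)
    (f : ℝ → EuclideanSpace ℝ (Fin d) → EuclideanSpace ℝ (Fin d) → EuclideanSpace ℝ (Fin d))
    (φ : ℝ → EuclideanSpace ℝ (Fin d))
    (hA1f : ∀ t ∈ Set.Icc (0:ℝ) (((n:ℝ)+1)*τ),
      Continuous (fun p : EuclideanSpace ℝ (Fin d) × EuclideanSpace ℝ (Fin d) => f t p.1 p.2))
    (hA2 : ∀ x z : EuclideanSpace ℝ (Fin d), Measurable (fun t => f t x z))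
    (hA1φ : ContinuousOn φ (Set.Icc (-τ) 0))
    -- the segments: `φseq j` is `φ_j` for `j = 0,…,n`; `Φ j` is `φ_{j-1}`
    (φseq : ℕ → ℝ → EuclideanSpace ℝ (Fin d))
    (Φ : ℕ → ℝ → EuclideanSpace ℝ (Fin d))
    (hΦ0 : ∀ t, Φ 0 t = φ (t - τ))
    (hΦs : ∀ j : ℕ, Φ (j+1) = φseq j)
    (hcont : ∀ j : ℕ, j ≤ n → ContinuousOn (φseq j) (Set.Icc (0:ℝ) τ))
    (hint : ∀ j : ℕ, j ≤ n →
      IntervalIntegrable (fun s => f (s + (j:ℝ) * τ) (φseq j s) (Φ j s))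
        MeasureTheory.volume 0 τ)
    (heq : ∀ j : ℕ, j ≤ n → ∀ t ∈ Set.Icc (0:ℝ) τ,
      φseq j t = Φ j τ + ∫ s in (0:ℝ)..t, f (s + (j:ℝ) * τ) (φseq j s) (Φ j s))
    -- the concatenated function
    (x : ℝ → EuclideanSpace ℝ (Fin d))
    (hxdef : ∀ t : ℝ, x t =
      if t = ((n:ℝ)+1)*τ then φseq n τ
      else ∑ j ∈ Finset.range (n+2),
        Set.indicator (Set.Ico (((j:ℝ)-1)*τ) ((j:ℝ)*τ))
          (fun s => Φ j (s - ((j:ℝ)-1)*τ)) t) :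
    ContinuousOn x (Set.Icc (0:ℝ) (((n:ℝ)+1)*τ)) ∧
    (∀ t ∈ Set.Ico (-τ) (0:ℝ), x t = φ t) ∧
    IntervalIntegrable (fun s => f s (x s) (x (s - τ)))
      MeasureTheory.volume 0 (((n:ℝ)+1)*τ) ∧
    (∀ t ∈ Set.Icc (0:ℝ) (((n:ℝ)+1)*τ),
      x t = x 0 + ∫ s in (0:ℝ)..t, f s (x s) (x (s - τ))) := by
  have H1 : ∀ j : ℕ, j ≤ n + 1 → ∀ t ∈ Set.Ico (((j:ℝ)-1)*τ) ((j:ℝ)*τ),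
      x t = Φ j (t - ((j:ℝ)-1)*τ) := by
    intro j hj t ht
    have hjn : (j:ℝ) ≤ (n:ℝ) + 1 := by exact_mod_cast hj
    have hne : t ≠ ((n:ℝ)+1)*τ := by
      have := mul_le_mul_of_nonneg_right hjn hτ.le
      have := ht.2
      intro h
      linarith
    rw [hxdef, if_neg hne, Finset.sum_eq_single j]
    · rw [Set.indicator_of_mem ht]
    · intro k _ hkj
      apply Set.indicator_of_notMem
      intro hk
      rcases lt_or_gt_of_ne hkj with h | h
      · have h' : (k:ℝ) ≤ (j:ℝ) - 1 := by
          have : (k:ℝ) + 1 ≤ j := by exact_mod_cast h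
          linarith
        have := mul_le_mul_of_nonneg_right h' hτ.le
        linarith [hk.2, ht.1]
      · have h' : (j:ℝ) ≤ (k:ℝ) - 1 := by
          have : (j:ℝ) + 1 ≤ k := by exact_mod_cast h
          linarith
        have := mul_le_mul_of_nonneg_right h' hτ.le
        linarith [hk.1, ht.2]
    · intro h
      exact absurd (Finset.mem_range.2 (by omega)) h
  have H0 : ∀ j : ℕ, j ≤ n → φseq j 0 = Φ j τ := by
    intro j hj
    rw [heq j hj 0 ⟨le_rfl, hτ.le⟩]
    simp
  have H2' : ∀ j : ℕ, j ≤ n → ∀ t ∈ Set.Ico ((j:ℝ)*τ) (((j:ℝ)+1)*τ),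
      x t = φseq j (t - (j:ℝ)*τ) := by
    intro j hj t ht
    have := H1 (j+1) (by omega) t (by push_cast; simpa using ht)
    rw [this, hΦs]
    push_cast
    congr 1
    ring
  have H2 : ∀ j : ℕ, j ≤ n → ∀ t ∈ Set.Icc ((j:ℝ)*τ) (((j:ℝ)+1)*τ),
      x t = φseq j (t - (j:ℝ)*τ) := by
    intro j hj t ht
    rcases lt_or_eq_of_le ht.2 with h | h
    · exact H2' j hj t ⟨ht.1, h⟩
    · have e : t - (j:ℝ)*τ = τ := by rw [h]; ring
      rw [e]
      rcases Nat.lt_or_eq_of_le hj with h1 | h1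
      · have := H2' (j+1) (by omega) t (by
          push_cast
          rw [h]
          exact ⟨le_rfl, by nlinarith⟩)
        rw [this]
        push_cast
        rw [h, sub_self, H0 (j+1) (by omega), hΦs]
      · subst h1
        rw [hxdef, if_pos h]
  have HG : ∀ j : ℕ, j ≤ n → ∀ s ∈ Set.Ico ((j:ℝ)*τ) (((j:ℝ)+1)*τ),
      (fun u => f (u + (j:ℝ) * τ) (φseq j u) (Φ j u)) (s - (j:ℝ)*τ)
        = f s (x s) (x (s - τ)) := by
    intro j hj s hs
    have h1 := H1 j (by omega) (s - τ) ⟨by linarith [hs.1], by linarith [hs.2]⟩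
    rw [H2' j hj s hs, h1]
    have e1 : s - τ - ((j:ℝ)-1)*τ = s - (j:ℝ)*τ := by ring
    have e2 : s - (j:ℝ)*τ + (j:ℝ)*τ = s := by ring
    simp only [e1, e2]
  have HI : ∀ j : ℕ, j ≤ n → IntervalIntegrable (fun s => f s (x s) (x (s - τ)))
      MeasureTheory.volume ((j:ℝ)*τ) (((j:ℝ)+1)*τ) := by
    intro j hj
    have h := (hint j hj).comp_sub_right ((j:ℝ)*τ)
    have e1 : 0 + (j:ℝ)*τ = (j:ℝ)*τ := by ring
    have e2 : τ + (j:ℝ)*τ = ((j:ℝ)+1)*τ := by ring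
    rw [e1, e2] at h
    have hle : (j:ℝ)*τ ≤ ((j:ℝ)+1)*τ := by nlinarith
    rw [intervalIntegrable_iff_integrableOn_Ico_of_le hle] at h ⊢
    exact h.congr_fun (HG j hj) measurableSet_Ico
  have HE : ∀ j : ℕ, j ≤ n → ∀ t ∈ Set.Icc ((j:ℝ)*τ) (((j:ℝ)+1)*τ),
      x t = x ((j:ℝ)*τ) + ∫ s in ((j:ℝ)*τ)..t, f s (x s) (x (s - τ)) := by
    intro j hj t ht
    have h0 := H2 j hj ((j:ℝ)*τ) ⟨le_rfl, by nlinarith⟩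
    rw [sub_self, H0 j hj] at h0
    rw [H2 j hj t ht, h0, heq j hj _ ⟨by linarith [ht.1], by linarith [ht.2]⟩]
    congr 1
    have h := intervalIntegral.integral_comp_sub_right (a := (j:ℝ)*τ) (b := t)
      (fun u => f (u + (j:ℝ) * τ) (φseq j u) (Φ j u)) ((j:ℝ)*τ)
    rw [sub_self] at h
    rw [← h, intervalIntegral.integral_of_le ht.1, intervalIntegral.integral_of_le ht.1,
      ← integral_Ico_eq_integral_Ioc, ← integral_Ico_eq_integral_Ioc]
    exact setIntegral_congr_fun measurableSet_Ico
      (fun s hs => HG j hj s ⟨hs.1, lt_of_lt_of_le hs.2 ht.2⟩)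
  have main : ∀ j : ℕ, j ≤ n + 1 →
      IntervalIntegrable (fun s => f s (x s) (x (s - τ))) MeasureTheory.volume 0 ((j:ℝ)*τ) ∧
      (∀ t ∈ Set.Icc (0:ℝ) ((j:ℝ)*τ),
        x t = x 0 + ∫ s in (0:ℝ)..t, f s (x s) (x (s - τ))) := by
    intro j
    induction j with
    | zero =>
      intro _
      refine ⟨by simp, ?_⟩
      intro t ht
      have : t = 0 := by
        have h2 := ht.2
        simp only [Nat.cast_zero, zero_mul] at h2
        exact le_antisymm h2 ht.1
      subst this
      simp
    | succ j ih =>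
      intro hj
      obtain ⟨i1, i2⟩ := ih (by omega)
      have hI := HI j (by omega)
      push_cast
      refine ⟨i1.trans hI, ?_⟩
      intro t ht
      have hj0 : 0 ≤ (j:ℝ)*τ := by positivity
      rcases le_total t ((j:ℝ)*τ) with h | h
      · exact i2 t ⟨ht.1, h⟩
      · rw [HE j (by omega) t ⟨h, ht.2⟩, i2 _ ⟨hj0, le_rfl⟩, add_assoc,
          intervalIntegral.integral_add_adjacent_intervals i1]
        apply hI.mono_set
        rw [Set.uIcc_of_le h, Set.uIcc_of_le (h.trans ht.2)]
        exact Set.Icc_subset_Icc le_rfl ht.2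
  have hm := main (n+1) le_rfl
  push_cast at hm
  obtain ⟨m1, m2⟩ := hm
  have hT : (0:ℝ) ≤ ((n:ℝ)+1)*τ := by positivity
  refine ⟨?_, ?_, m1, m2⟩
  · have hc := intervalIntegral.continuousOn_primitive_interval' m1
      (Set.left_mem_uIcc)
    rw [Set.uIcc_of_le hT] at hc
    exact (continuousOn_const.add hc).congr m2
  · intro t ht
    have := H1 0 (by omega) t (by simpa using ht)
    rw [this, hΦ0]
    congr 1
    push_cast
    ring
end
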